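/- arXiv:1706.06095 — 2 statements merged into one kernel-verified Lean document; each statement's English description precedes it below -/
import Mathlib

section
/- For every ε > 0 there exist a positive integer n and a grid-like sequence of closed sets A_0, A_1, …, A_n ⊆ ℝ² (with the Euclidean norm) such that every transversal T = (a_0, …, a_n), a_i ∈ A_i, satisfies D(T) ≥ 4√(2 − √3) − ε, where 4√(2 − √3) ≈ 2.071. -/
/-- The point `(x, y)` lies in the cell attached to the lattice point `(p, q)`, `p + q` odd. A cell
with `|q| < |p|` is a vertical segment of half-length `H`, pushed outwards by `W`; a cell with
`|p| < |q|` is a horizontal segment of half-length `W`, pushed outwards by `H`. -/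
structure InCell (H W : ℝ) (p q : ℤ) (x y : ℝ) : Prop where
  odd : Odd (p + q)
  abs_x : |x - p| ≤ W
  abs_y : |y - q| ≤ H
  right : |q| < p → x - p = W
  left : |q| < -p → x - p = -W
  top : |p| < q → y - q = H
  bottom : |p| < -q → y - q = -H

/-- The union of all cells. -/
def cellGrid (H W : ℝ) : Set (EuclideanSpace ℝ (Fin 2)) :=
  {a | ∃ p q : ℤ, InCell H W p q (a 0) (a 1)}

lemma InCell.swap {H W : ℝ} {p q : ℤ} {x y : ℝ} (h : InCell H W p q x y) :
    InCell W H q p y x :=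
  ⟨by rw [add_comm]; exact h.odd, h.abs_y, h.abs_x, h.top, h.bottom, h.right, h.left⟩

lemma InCell.neg_left {H W : ℝ} {p q : ℤ} {x y : ℝ} (h : InCell H W p q x y) :
    InCell H W (-p) q (-x) y where
  odd := by
    have := h.odd
    rw [Int.odd_iff] at this ⊢
    omega
  abs_x := by
    have := h.abs_x
    rw [abs_le] at this ⊢
    push_cast
    constructor <;> linarith
  abs_y := h.abs_y
  right := fun hq => by have := h.left hq; push_cast; linarith
  left := fun hq => by have := h.right (by simpa using hq); push_cast; linarith
  top := fun hq => h.top (by simpa using hq)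
  bottom := fun hq => h.bottom (by simpa using hq)

lemma InCell.neg_right {H W : ℝ} {p q : ℤ} {x y : ℝ} (h : InCell H W p q x y) :
    InCell H W p (-q) x (-y) :=
  h.swap.neg_left.swap

lemma isClosed_cellGrid (H W : ℝ) : IsClosed (cellGrid H W) := by
  have hU : cellGrid H W =
      ⋃ r : ℤ × ℤ, {a : EuclideanSpace ℝ (Fin 2) | InCell H W r.1 r.2 (a 0) (a 1)} := by
    ext a
    simp [cellGrid]
  rw [hU]
  refine LocallyFinite.isClosed_iUnion ?_ ?_
  · intro a
    refine ⟨{b | |b 0 - a 0| < 1 ∧ |b 1 - a 1| < 1}, ?_, ?_⟩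
    · refine IsOpen.mem_nhds ?_ (by simp)
      refine IsOpen.inter ?_ ?_
      · exact isOpen_lt (f := fun b : EuclideanSpace ℝ (Fin 2) => |b 0 - a 0|) (by fun_prop)
          continuous_const
      · exact isOpen_lt (f := fun b : EuclideanSpace ℝ (Fin 2) => |b 1 - a 1|) (by fun_prop)
          continuous_const
    · refine ((Set.finite_Icc ⌊a 0 - 1 - W⌋ ⌈a 0 + 1 + W⌉).prod
        (Set.finite_Icc ⌊a 1 - 1 - H⌋ ⌈a 1 + 1 + H⌉)).subset ?_
      rintro ⟨p, q⟩ ⟨b, hb, hb0, hb1⟩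
      have hx := abs_le.1 hb.abs_x
      have hy := abs_le.1 hb.abs_y
      rw [abs_lt] at hb0 hb1
      simp only at hx hy
      refine ⟨⟨?_, ?_⟩, ?_, ?_⟩ <;> rw [← Int.cast_le (R := ℝ)]
      · exact (Int.floor_le _).trans (by linarith)
      · exact le_trans (by linarith) (Int.le_ceil _)
      · exact (Int.floor_le _).trans (by linarith)
      · exact le_trans (by linarith) (Int.le_ceil _)
  · rintro ⟨p, q⟩
    have himp : ∀ (P : Prop) (f : EuclideanSpace ℝ (Fin 2) → ℝ) (c : ℝ), Continuous f →
        IsClosed {a | P → f a = c} := by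
      intro P f c hf
      by_cases hP : P
      · simpa [hP] using isClosed_eq hf continuous_const
      · simp [hP]
    have habs : ∀ (k : Fin 2) (u c : ℝ),
        IsClosed {a : EuclideanSpace ℝ (Fin 2) | |a k - u| ≤ c} := fun k u c =>
      isClosed_le (f := fun a : EuclideanSpace ℝ (Fin 2) => |a k - u|) (by fun_prop)
        continuous_const
    have hcoord : ∀ (P : Prop) (k : Fin 2) (u c : ℝ),
        IsClosed {a : EuclideanSpace ℝ (Fin 2) | P → a k - u = c} := fun P k u c =>
      himp P (fun a : EuclideanSpace ℝ (Fin 2) => a k - u) c (by fun_prop)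
    have hS : {a : EuclideanSpace ℝ (Fin 2) | InCell H W p q (a 0) (a 1)} =
        {_a | Odd (p + q)} ∩ ({a | |a 0 - (p : ℝ)| ≤ W} ∩ ({a | |a 1 - (q : ℝ)| ≤ H} ∩
          ({a | |q| < p → a 0 - (p : ℝ) = W} ∩ ({a | |q| < -p → a 0 - (p : ℝ) = -W} ∩
          ({a | |p| < q → a 1 - (q : ℝ) = H} ∩ {a | |p| < -q → a 1 - (q : ℝ) = -H}))))) := by
      ext a
      exact ⟨fun h => ⟨h.1, h.2, h.3, h.4, h.5, h.6, h.7⟩,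
        fun ⟨h1, h2, h3, h4, h5, h6, h7⟩ => ⟨h1, h2, h3, h4, h5, h6, h7⟩⟩
    rw [hS]
    exact isClosed_const.inter ((habs _ _ _).inter ((habs _ _ _).inter ((hcoord _ _ _ _).inter
      ((hcoord _ _ _ _).inter ((hcoord _ _ _ _).inter (hcoord _ _ _ _))))))

lemma exists_odd_near (x : ℝ) : ∃ m : ℤ, |x - (2 * m + 1)| ≤ 1 := by
  refine ⟨⌊x / 2⌋, ?_⟩
  have h1 := Int.floor_le (x / 2)
  have h2 := Int.lt_floor_add_one (x / 2)
  rw [abs_le]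
  constructor <;> linarith

lemma exists_odd_lattice_near (x y : ℝ) :
    ∃ p q : ℤ, Odd (p + q) ∧ (x - p) ^ 2 + (y - q) ^ 2 ≤ 1 := by
  obtain ⟨m, hm⟩ := exists_odd_near (x + y)
  obtain ⟨k, hk⟩ := exists_odd_near (x - y)
  refine ⟨m + k + 1, m - k, ⟨m, by ring⟩, ?_⟩
  have h1 := sq_le_one_iff_abs_le_one _ |>.2 hm
  have h2 := sq_le_one_iff_abs_le_one _ |>.2 hk
  push_cast
  nlinarith

lemma exists_inCell_zero_near {H : ℝ} (hH : 0 ≤ H) (x y : ℝ) :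
    ∃ (p q : ℤ) (x' y' : ℝ), InCell H 0 p q x' y' ∧ (x' - x) ^ 2 + (y' - y) ^ 2 ≤ 1 := by
  rcases lt_or_ge H |y| with hy | hy
  · wlog hpos : 0 < y generalizing y
    · obtain ⟨p, q, x', y', hc, hd⟩ := this (-y) (by rwa [abs_neg]) (by
        by_contra hn
        have : y = 0 := by linarith
        simp [this] at hy
        linarith)
      exact ⟨p, -q, x', -y', hc.neg_right, by nlinarith⟩
    rw [abs_of_pos hpos] at hy
    obtain ⟨p, q, ho, hd⟩ := exists_odd_lattice_near x (y - H)
    refine ⟨p, q, p, q + H, ⟨ho, by simp, by simp [abs_of_nonneg hH], by simp, by simp, by simp,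
      fun hq => ?_⟩, by nlinarith⟩
    exfalso
    have h1 : q ≤ -1 := by have := abs_nonneg p; omega
    have h2 : (q : ℝ) ≤ -1 := by exact_mod_cast h1
    nlinarith [sq_nonneg (x - p)]
  · obtain ⟨m, hm⟩ := exists_odd_near x
    refine ⟨2 * m + 1, 0, (2 * m + 1 : ℤ), y, ⟨⟨m, by ring⟩, by simp, by simpa using hy, by simp,
      by simp, fun h => ?_, fun h => ?_⟩, ?_⟩
    · have := abs_nonneg (2 * m + 1); omega
    · have := abs_nonneg (2 * m + 1); omega
    · have := sq_le_one_iff_abs_le_one _ |>.2 hm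
      push_cast
      nlinarith

lemma exists_mem_cellGrid_near {H W : ℝ} (hH : 0 ≤ H) (hW : 0 ≤ W) (h0 : W = 0 ∨ H = 0)
    (a : EuclideanSpace ℝ (Fin 2)) : ∃ b ∈ cellGrid H W, ‖b - a‖ ≤ 1 := by
  have key : ∃ (p q : ℤ) (x y : ℝ), InCell H W p q x y ∧ (x - a 0) ^ 2 + (y - a 1) ^ 2 ≤ 1 := by
    rcases h0 with rfl | rfl
    · exact exists_inCell_zero_near hH _ _
    · obtain ⟨p, q, x, y, hc, hd⟩ := exists_inCell_zero_near hW (a 1) (a 0)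
      exact ⟨q, p, y, x, hc.swap, by linarith⟩
  obtain ⟨p, q, x, y, hc, hd⟩ := key
  refine ⟨!₂[x, y], ⟨p, q, by simpa using hc⟩, ?_⟩
  rw [EuclideanSpace.norm_eq]
  refine Real.sqrt_le_iff.2 ⟨zero_le_one, ?_⟩
  simpa [Fin.sum_univ_two] using hd

/-- A triangle whose bounding box has both sides at least `σ`, with one vertex at a corner of the
box, has a side of length at least `2 * √(2 - √3) * σ`. -/
lemma triangle_box {σ r P₁ P₂ J₁ J₂ Q₁ Q₂ : ℝ} (hσ : 0 < σ) (hr : r ^ 2 = 3) (hr1 : 1 < r)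
    (hr2 : r < 2) (hP : σ ≤ P₁ - J₁) (hQ : σ ≤ J₂ - Q₂)
    (hPJ : (P₁ - J₁) ^ 2 + (P₂ - J₂) ^ 2 < σ ^ 2 * (8 - 4 * r))
    (hJQ : (J₁ - Q₁) ^ 2 + (J₂ - Q₂) ^ 2 < σ ^ 2 * (8 - 4 * r))
    (hPQ : (P₁ - Q₁) ^ 2 + (P₂ - Q₂) ^ 2 < σ ^ 2 * (8 - 4 * r)) : False := by
  have hs : 0 ≤ (2 - r) * σ := mul_nonneg (by linarith) hσ.le
  have hsq : ((2 - r) * σ) ^ 2 = σ ^ 2 * (7 - 4 * r) := by linear_combination σ ^ 2 * hr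
  have h1 : |P₂ - J₂| < (2 - r) * σ := by
    refine abs_lt_of_sq_lt_sq ?_ hs
    nlinarith
  have h2 : |J₁ - Q₁| < (2 - r) * σ := by
    refine abs_lt_of_sq_lt_sq ?_ hs
    nlinarith
  rw [abs_lt] at h1 h2
  have ht : 0 ≤ (r - 1) * σ := mul_nonneg (by linarith) hσ.le
  have h3 : (r - 1) * σ ≤ P₁ - Q₁ := by nlinarith
  have h4 : (r - 1) * σ ≤ P₂ - Q₂ := by nlinarith
  have h5 := pow_le_pow_left₀ ht h3 2
  have h6 := pow_le_pow_left₀ ht h4 2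
  have h7 : ((r - 1) * σ) ^ 2 = σ ^ 2 * (4 - 2 * r) := by linear_combination σ ^ 2 * hr
  linarith

/-- A step between nearby grids that crosses the diagonal upwards. -/
lemma InCell.step_of_cross {H W H' W' δ x y x' y' : ℝ} {p q p' q' : ℤ} (hH : |H' - H| ≤ δ) (hW : |W' - W| ≤ δ)
    (h : InCell H W p q x y) (h' : InCell H' W' p' q' x' y') (hlt : q < p) (hlt' : p' < q') :
    (x' - x ≤ -1 + δ ∧ 1 - δ ≤ y' - y) ∨ x' - x ≤ -2 + δ ∨ 2 - δ ≤ y' - y := by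
  have hx := abs_le.1 h.abs_x
  have hy := abs_le.1 h.abs_y
  have hx' := abs_le.1 h'.abs_x
  have hy' := abs_le.1 h'.abs_y
  rw [abs_le] at hH hW
  have ho := Int.odd_iff.1 h.odd
  have ho' := Int.odd_iff.1 h'.odd
  have main : x' - x ≤ (p' - p : ℤ) + δ → (q' - q : ℤ) - δ ≤ y' - y →
      (x' - x ≤ -1 + δ ∧ 1 - δ ≤ y' - y) ∨ x' - x ≤ -2 + δ ∨ 2 - δ ≤ y' - y := by
    intro h1 h2
    rcases (by omega : (p' - p ≤ -1 ∧ 1 ≤ q' - q) ∨ p' - p ≤ -2 ∨ 2 ≤ q' - q) with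
      ⟨e1, e2⟩ | e | e
    · have e1' : ((p' - p : ℤ) : ℝ) ≤ -1 := by exact_mod_cast e1
      have e2' : (1 : ℝ) ≤ ((q' - q : ℤ) : ℝ) := by exact_mod_cast e2
      exact Or.inl ⟨by linarith, by linarith⟩
    · have e' : ((p' - p : ℤ) : ℝ) ≤ -2 := by exact_mod_cast e
      exact Or.inr (Or.inl (by linarith))
    · have e' : (2 : ℝ) ≤ ((q' - q : ℤ) : ℝ) := by exact_mod_cast e
      exact Or.inr (Or.inr (by linarith))
  have hsrc : |q| < p ∨ |p| < -q := by
    rcases abs_cases p with ⟨e, _⟩ | ⟨e, _⟩ <;> rcases abs_cases q with ⟨e', _⟩ | ⟨e', _⟩ <;> omega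
  have htgt : |q'| < -p' ∨ |p'| < q' := by
    rcases abs_cases p' with ⟨e, _⟩ | ⟨e, _⟩ <;> rcases abs_cases q' with ⟨e', _⟩ | ⟨e', _⟩ <;>
      omega
  rcases hsrc with hs | hs <;> rcases htgt with ht | ht
  · have e1 := h.right hs
    have e2 := h'.left ht
    have f1 : (1 : ℝ) ≤ p := by
      have : 1 ≤ p := by have := abs_nonneg q; omega
      exact_mod_cast this
    have f2 : (p' : ℝ) ≤ -1 := by
      have : p' ≤ -1 := by have := abs_nonneg q'; omega
      exact_mod_cast this
    exact Or.inr (Or.inl (by linarith))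
  · have e1 := h.right hs
    have e2 := h'.top ht
    exact main (by push_cast; linarith) (by push_cast; linarith)
  · have e1 := h.bottom hs
    have e2 := h'.left ht
    exact main (by push_cast; linarith) (by push_cast; linarith)
  · have e1 := h.bottom hs
    have e2 := h'.top ht
    have f1 : (q : ℝ) ≤ -1 := by
      have : q ≤ -1 := by have := abs_nonneg p; omega
      exact_mod_cast this
    have f2 : (1 : ℝ) ≤ q' := by
      have : 1 ≤ q' := by have := abs_nonneg p'; omega
      exact_mod_cast this
    exact Or.inr (Or.inr (by linarith))

/-- A walk that starts to the right and ends above must cross the diagonal at a large cost. -/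
lemma false_of_walk {N : ℕ} {δ σ r : ℝ} {H W x y : ℕ → ℝ} {p q : ℕ → ℤ}
    (hδ : 0 ≤ δ) (hδ2 : δ ≤ 1 / 2) (hσ : σ = 2 - δ) (hr : r ^ 2 = 3) (hr1 : 8 / 5 < r)
    (hr2 : r < 2)
    (hH : ∀ i, |H (i + 1) - H i| ≤ δ) (hW : ∀ i, |W (i + 1) - W i| ≤ δ)
    (hc : ∀ i, 1 ≤ i → i ≤ N → InCell (H i) (W i) (p i) (q i) (x i) (y i))
    (hN : 1 ≤ N) (hx0 : x 0 = 0) (hyN : y (N + 1) = 0)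
    (hd : ∀ i j, i ≤ N → j ≤ N →
      (x (i + 1) - x i - (x (j + 1) - x j)) ^ 2 + (y (i + 1) - y i - (y (j + 1) - y j)) ^ 2 <
        σ ^ 2 * (8 - 4 * r))
    (hx1 : 1 ≤ x 1) (hy1 : 1 ≤ y N) (hs : q 1 < p 1) (ht : p N < q N) : False := by
  have hstep : ∃ i, 1 ≤ i ∧ i < N ∧ q i < p i ∧ p (i + 1) < q (i + 1) := by
    by_contra! hcon
    have hall : ∀ i, 1 ≤ i → i ≤ N → q i < p i := by
      intro i hi
      induction i, hi using Nat.le_induction with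
      | base => exact fun _ => hs
      | succ k hk ih =>
        intro hkN
        have h1 := hcon k hk (by omega) (ih (by omega))
        have h2 := Int.odd_iff.1 (hc (k + 1) (by omega) hkN).odd
        omega
    exact absurd (hall N hN le_rfl) (by omega)
  obtain ⟨i, hi1, hiN, hb, ha⟩ := hstep
  have h := (hc i hi1 (by omega)).step_of_cross (hH i) (hW i) (hc (i + 1) (by omega) (by omega))
    hb ha
  have d1 := hd 0 i (by omega) (by omega)
  have d2 := hd i N (by omega) le_rfl
  have d3 := hd 0 N (by omega) le_rfl
  simp only [zero_add] at d1 d3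
  have hbound : σ ^ 2 * (8 - 4 * r) < (5 / 2) ^ 2 := by
    have : σ ^ 2 ≤ 4 := by nlinarith
    nlinarith
  rcases h with ⟨e1, e2⟩ | e | e
  · exact triangle_box (by linarith) hr (by linarith) hr2 (by linarith) (by linarith) d1 d2 d3
  · nlinarith [sq_nonneg (y 1 - y 0 - (y (i + 1) - y i))]
  · nlinarith [sq_nonneg (x (i + 1) - x i - (x (N + 1) - x N))]

/-- If the increments of a closed walk differ by less than `5 / 2`, each is less than `5 / 2`. -/
lemma abs_increment_lt {N : ℕ} {x : ℕ → ℝ} (hx : x (N + 1) = x 0)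
    (hd : ∀ i j, i ≤ N → j ≤ N → x (i + 1) - x i - (x (j + 1) - x j) < 5 / 2) {i : ℕ}
    (hi : i ≤ N) : |x (i + 1) - x i| < 5 / 2 := by
  have hsum : ∑ j ∈ Finset.range (N + 1), (x (j + 1) - x j) = 0 := by
    rw [Finset.sum_range_sub, hx, sub_self]
  have hne : (Finset.range (N + 1)).Nonempty := ⟨0, by simp⟩
  rw [abs_lt]
  constructor
  · obtain ⟨j, hj, hj0⟩ := Finset.exists_le_of_sum_le hne
      (f := fun _ => (0 : ℝ)) (g := fun j => x (j + 1) - x j) (by simp [hsum])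
    have := hd j i (by simpa [Nat.lt_succ_iff] using hj) hi
    linarith
  · obtain ⟨j, hj, hj0⟩ := Finset.exists_le_of_sum_le hne
      (g := fun _ => (0 : ℝ)) (f := fun j => x (j + 1) - x j) (by simp [hsum])
    have := hd i j hi (by simpa [Nat.lt_succ_iff] using hj)
    linarith

/-- In a grid with `H = 3`, `W = 0`, a point of height less than `5 / 2` lies in a vertical cell. -/
lemma InCell.abs_lt_of_flat {p q : ℤ} {x y : ℝ} (h : InCell 3 0 p q x y) (hy : |y| < 5 / 2) :
    |q| < |p| ∧ x = p := by
  have ho := Int.odd_iff.1 h.odd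
  have hx := abs_nonpos_iff.1 h.abs_x
  rw [abs_lt] at hy
  refine ⟨?_, by linarith⟩
  by_contra hn
  have hpq : |p| < q ∨ |p| < -q := by
    rcases abs_cases p with ⟨e, _⟩ | ⟨e, _⟩ <;> rcases abs_cases q with ⟨e', _⟩ | ⟨e', _⟩ <;> omega
  have hp := abs_nonneg p
  rcases hpq with hq | hq
  · have := h.top hq
    have : (0 : ℝ) < q := by exact_mod_cast (by omega : 0 < q)
    linarith
  · have := h.bottom hq
    have : (q : ℝ) < 0 := by exact_mod_cast (by omega : q < 0)
    linarith

/-- No closed walk through the slowly varying grids has all increments close together. -/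
lemma false_of_closed_walk {N : ℕ} {δ σ r : ℝ} {H W x y : ℕ → ℝ}
    (hδ : 0 ≤ δ) (hδ2 : δ ≤ 1 / 2) (hσ : σ = 2 - δ) (hr : r ^ 2 = 3) (hr1 : 8 / 5 < r)
    (hr2 : r < 2)
    (hH : ∀ i, |H (i + 1) - H i| ≤ δ) (hW : ∀ i, |W (i + 1) - W i| ≤ δ)
    (hH1 : H 1 = 3) (hW1 : W 1 = 0) (hHN : H N = 0) (hWN : W N = 3)
    (hc : ∀ i, 1 ≤ i → i ≤ N → ∃ p q : ℤ, InCell (H i) (W i) p q (x i) (y i))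
    (hN : 1 ≤ N) (hx0 : x 0 = 0) (hy0 : y 0 = 0) (hxN : x (N + 1) = 0) (hyN : y (N + 1) = 0)
    (hd : ∀ i j, i ≤ N → j ≤ N →
      (x (i + 1) - x i - (x (j + 1) - x j)) ^ 2 + (y (i + 1) - y i - (y (j + 1) - y j)) ^ 2 <
        σ ^ 2 * (8 - 4 * r)) : False := by
  have hbound : σ ^ 2 * (8 - 4 * r) < (5 / 2) ^ 2 := by
    have : σ ^ 2 ≤ 4 := by nlinarith
    nlinarith
  have hy1 : |y 1| < 5 / 2 := by
    have := abs_increment_lt (x := y) (N := N) (by rw [hyN, hy0]) (fun i j hi hj => by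
      have := hd i j hi hj
      refine lt_of_pow_lt_pow_left₀ 2 (by norm_num) ?_
      nlinarith [sq_nonneg (x (i + 1) - x i - (x (j + 1) - x j))]) (Nat.zero_le N)
    simpa [hy0] using this
  have hxN' : |x N| < 5 / 2 := by
    have := abs_increment_lt (x := x) (N := N) (by rw [hxN, hx0]) (fun i j hi hj => by
      have := hd i j hi hj
      refine lt_of_pow_lt_pow_left₀ 2 (by norm_num) ?_
      nlinarith [sq_nonneg (y (i + 1) - y i - (y (j + 1) - y j))]) le_rfl
    simpa [hxN] using this
  choose! p q hpq using hc
  obtain ⟨h1, h1'⟩ := (by simpa only [hH1, hW1] using hpq 1 le_rfl hN :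
    InCell 3 0 (p 1) (q 1) (x 1) (y 1)).abs_lt_of_flat hy1
  obtain ⟨h2, h2'⟩ := (by simpa only [hHN, hWN] using hpq N hN le_rfl :
    InCell 0 3 (p N) (q N) (x N) (y N)).swap.abs_lt_of_flat hxN'
  have one_le : ∀ m : ℤ, 0 < m → (1 : ℝ) ≤ m := fun m hm => by exact_mod_cast hm
  have hp1 := abs_nonneg (q 1)
  have hq1 := abs_nonneg (p N)
  have a1 := le_abs_self (q 1)
  have a2 := neg_le_abs (q 1)
  have a3 := le_abs_self (p N)
  have a4 := neg_le_abs (p N)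
  rcases abs_cases (p 1) with ⟨e, _⟩ | ⟨e, _⟩ <;> rcases abs_cases (q N) with ⟨e', _⟩ | ⟨e', _⟩
  · exact false_of_walk hδ hδ2 hσ hr hr1 hr2 hH hW hpq hN hx0 hyN hd
      (by rw [h1']; exact one_le _ (by omega)) (by rw [h2']; exact one_le _ (by omega))
      (by omega) (by omega)
  · refine false_of_walk (y := fun i => -y i) (q := fun i => -q i) hδ hδ2 hσ hr hr1 hr2 hH hW
      (fun i hi hi' => (hpq i hi hi').neg_right) hN hx0 (by simp [hyN])
      (fun i j hi hj => by have := hd i j hi hj; ring_nf at this ⊢; exact this)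
      (by rw [h1']; exact one_le _ (by omega)) ?_ (by omega) (by omega)
    have := one_le (-q N) (by omega)
    push_cast at this
    linarith
  · refine false_of_walk (x := fun i => -x i) (p := fun i => -p i) hδ hδ2 hσ hr hr1 hr2 hH hW
      (fun i hi hi' => (hpq i hi hi').neg_left) hN (by simp [hx0]) hyN
      (fun i j hi hj => by have := hd i j hi hj; ring_nf at this ⊢; exact this)
      ?_ (by rw [h2']; exact one_le _ (by omega)) (by omega) (by omega)
    have := one_le (-p 1) (by omega)
    push_cast at this
    linarith
  · refine false_of_walk (x := fun i => -x i) (p := fun i => -p i) (y := fun i => -y i)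
      (q := fun i => -q i) hδ hδ2 hσ hr hr1 hr2 hH hW
      (fun i hi hi' => (hpq i hi hi').neg_left.neg_right) hN (by simp [hx0]) (by simp [hyN])
      (fun i j hi hj => by have := hd i j hi hj; ring_nf at this ⊢; exact this)
      ?_ ?_ (by omega) (by omega)
    · have := one_le (-p 1) (by omega)
      push_cast at this
      linarith
    · have := one_le (-q N) (by omega)
      push_cast at this
      linarith

/-- **Theorem 3**: `D*_2 ≥ 4√(2 − √3) ≈ 2.071`. For every `ε > 0` there exist `n ≥ 1`
and a grid-like sequence of closed sets `A 0, …, A n ⊆ ℝ²` (Euclidean norm) such that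
every transversal `a i ∈ A i` has two differences `z i = a i − a (i−1)`,
`z j = a j − a (j−1)` with `‖z i − z j‖ ≥ 4√(2 − √3) − ε`. -/
theorem lower_bound_two_point_07 (ε : ℝ) (hε : 0 < ε) :
    ∃ (n : ℕ) (A : ℕ → Set (EuclideanSpace ℝ (Fin 2))) (s : EuclideanSpace ℝ (Fin 2)),
      1 ≤ n ∧
      (∀ i, i ≤ n → IsClosed (A i)) ∧
      A 0 = {0} ∧ A n = {s} ∧
      (∀ i, 1 ≤ i → i < n → ∀ a : EuclideanSpace ℝ (Fin 2), ∃ y ∈ A i, ‖y - a‖ ≤ 1) ∧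
      ∀ a : ℕ → EuclideanSpace ℝ (Fin 2), (∀ i, i ≤ n → a i ∈ A i) →
        ∃ i j, 1 ≤ i ∧ i ≤ n ∧ 1 ≤ j ∧ j ≤ n ∧
          4 * Real.sqrt (2 - Real.sqrt 3) - ε ≤ ‖(a i - a (i - 1)) - (a j - a (j - 1))‖ := by
  obtain ⟨M, hM⟩ := exists_nat_ge (max 6 (6 / ε))
  have hM6 : (6 : ℝ) ≤ M := (le_max_left _ _).trans hM
  have hMε : 6 / ε ≤ M := (le_max_right _ _).trans hM
  have hM0 : (0 : ℝ) < M := by linarith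
  obtain ⟨δ, hδdef⟩ : ∃ δ : ℝ, δ = 3 / M := ⟨_, rfl⟩
  have hδ0 : 0 ≤ δ := by rw [hδdef]; positivity
  have hδM : M * δ = 3 := by rw [hδdef]; field_simp
  have hδ2 : δ ≤ 1 / 2 := by nlinarith
  have hδε : 2 * δ ≤ ε := by
    rw [div_le_iff₀ hε] at hMε
    nlinarith
  let τ : ℕ → ℝ := fun i => 3 - δ * (i - 1)
  have hτ : ∀ i, τ (i + 1) = τ i - δ := fun i => by simp only [τ]; push_cast; ring
  let H : ℕ → ℝ := fun i => max (τ i) 0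
  let W : ℕ → ℝ := fun i => max (-τ i) 0
  have hτ1 : τ 1 = 3 := by simp [τ]
  have hτN : τ (2 * M + 1) = -3 := by simp only [τ]; push_cast; linarith
  refine ⟨2 * M + 1 + 1, fun i => if i = 0 ∨ i = 2 * M + 1 + 1 then {0} else cellGrid (H i) (W i),
    0, by omega, ?_, by simp, by simp, ?_, ?_⟩
  · intro i _
    dsimp only
    split_ifs
    · exact isClosed_singleton
    · exact isClosed_cellGrid _ _
  · intro i hi hi' a
    dsimp only
    rw [if_neg (by omega)]
    refine exists_mem_cellGrid_near (le_max_right _ _) (le_max_right _ _) ?_ a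
    rcases le_total 0 (τ i) with h | h
    · exact Or.inl (max_eq_right (by linarith))
    · exact Or.inr (max_eq_right h)
  · intro a ha
    by_contra! hcon
    have ha0 : a 0 = 0 := by simpa using ha 0 (by omega)
    have haN : a (2 * M + 1 + 1) = 0 := by simpa using ha (2 * M + 1 + 1) le_rfl
    have hr : (√3 : ℝ) ^ 2 = 3 := Real.sq_sqrt (by norm_num)
    have hr1 : 8 / 5 < √3 := Real.lt_sqrt_of_sq_lt (by norm_num)
    have hr2 : √3 < 2 := by
      rw [Real.sqrt_lt' (by norm_num)]
      norm_num
    have hs : √(2 - √3) ^ 2 = 2 - √3 := Real.sq_sqrt (by linarith)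
    have hs1 : √(2 - √3) ≤ 1 := Real.sqrt_le_iff.2 ⟨zero_le_one, by linarith⟩
    refine false_of_closed_walk (N := 2 * M + 1) (H := H) (W := W) (x := fun i => a i 0)
      (y := fun i => a i 1) hδ0 hδ2 rfl hr hr1 hr2 ?_ ?_ (by simp [H, hτ1]) (by simp [W, hτ1])
      (by simp [H, hτN]) (by simp [W, hτN]) ?_ (by omega) (by simp [ha0]) (by simp [ha0])
      (by simp [haN]) (by simp [haN]) ?_
    · intro i
      refine (abs_max_sub_max_le_abs _ _ _).trans ?_
      rw [hτ, sub_sub_cancel_left, abs_neg, abs_of_nonneg hδ0]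
    · intro i
      refine (abs_max_sub_max_le_abs _ _ _).trans ?_
      rw [hτ, show -(τ i - δ) - -τ i = δ by ring, abs_of_nonneg hδ0]
    · intro i hi hi'
      have := ha i (by omega)
      dsimp only at this
      rw [if_neg (by omega)] at this
      exact this
    · intro i j hi hj
      have h := hcon (i + 1) (j + 1) (by omega) (by omega) (by omega) (by omega)
      simp only [Nat.add_sub_cancel] at h
      have h' : ‖a (i + 1) - a i - (a (j + 1) - a j)‖ < (2 - δ) * (2 * √(2 - √3)) := by
        nlinarith
      have h2 := pow_lt_pow_left₀ h' (norm_nonneg _) two_ne_zero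
      rw [EuclideanSpace.norm_sq_eq, mul_pow, mul_pow, hs] at h2
      simp only [Fin.sum_univ_two, PiLp.sub_apply, Real.norm_eq_abs, sq_abs] at h2
      linarith
end

section
/- For every ε > 0 there exist a positive integer n and a grid-like sequence of closed sets A_0, A_1, …, A_n ⊆ ℝ² (with the Euclidean norm) such that every transversal T = (a_0, …, a_n), a_i ∈ A_i, satisfies D(T) ≥ 1 + √2 − ε. -/
/-- The rows `u ∈ √2 (ℤ + 1/2)` of points spaced by `√2` in the `v`-direction, those with `u > 0`
being translated by `c` and those with `u < 0` by `-c`. -/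
def SlidRows (c u v : ℝ) : Prop :=
  Real.cos (Real.pi * u / Real.sqrt 2) = 0 ∧
    ((0 ≤ u ∧ Real.sin (Real.pi * (v - c) / Real.sqrt 2) = 0) ∨
      (u ≤ 0 ∧ Real.sin (Real.pi * (v + c) / Real.sqrt 2) = 0))

namespace SlidRows

lemma sqrt_two_mul_of_pi_mul {u t : ℝ} (h : Real.pi * u / Real.sqrt 2 = t * Real.pi) :
    u = Real.sqrt 2 * t := by
  have h2 : Real.sqrt 2 ≠ 0 := by positivity
  have hp := Real.pi_ne_zero
  rw [div_eq_iff h2] at h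
  apply mul_left_cancel₀ hp
  linarith

lemma exists_row {c u v : ℝ} (h : SlidRows c u v) : ∃ k : ℤ, u = Real.sqrt 2 * (k + 1 / 2) := by
  obtain ⟨k, hk⟩ := Real.cos_eq_zero_iff.1 h.1
  exact ⟨k, sqrt_two_mul_of_pi_mul (by rw [hk]; ring)⟩

lemma neg {c u v : ℝ} (h : SlidRows c u v) : SlidRows c (-u) (-v) := by
  obtain ⟨h1, h2⟩ := h
  refine ⟨?_, ?_⟩
  · rw [← h1, ← Real.cos_neg]
    congr 1
    ring
  · rcases h2 with ⟨hu, hs⟩ | ⟨hu, hs⟩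
    · refine Or.inr ⟨by linarith, ?_⟩
      rw [← neg_eq_zero, ← hs, ← Real.sin_neg]
      congr 1
      ring
    · refine Or.inl ⟨by linarith, ?_⟩
      rw [← neg_eq_zero, ← hs, ← Real.sin_neg]
      congr 1
      ring

lemma le_or_ge {c u v : ℝ} (h : SlidRows c u v) :
    u ≤ -(Real.sqrt 2 / 2) ∨ Real.sqrt 2 / 2 ≤ u := by
  obtain ⟨k, rfl⟩ := h.exists_row
  have h2 : 0 < Real.sqrt 2 := by positivity
  rcases le_or_gt 0 k with hk | hk
  · have : (0 : ℝ) ≤ k := by exact_mod_cast hk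
    right
    nlinarith
  · have : (k : ℝ) ≤ -1 := by exact_mod_cast Int.le_sub_one_of_lt hk
    left
    nlinarith

lemma exists_of_neg {c u v : ℝ} (h : SlidRows c u v) (hu : u < 0) :
    ∃ m : ℤ, v = Real.sqrt 2 * m - c := by
  rcases h.2 with ⟨h0, -⟩ | ⟨-, hs⟩
  · linarith
  · obtain ⟨m, hm⟩ := Real.sin_eq_zero_iff.1 hs
    exact ⟨m, by linarith [sqrt_two_mul_of_pi_mul hm.symm]⟩

lemma mul_int_nonpos {t s : ℝ} {k : ℤ} (ht : t = Real.sqrt 2 * k - s)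
    (h : t < Real.sqrt 2 - s) : t ≤ -s := by
  have h2 : 0 < Real.sqrt 2 := by positivity
  have hk : (k : ℝ) < 1 := by
    by_contra! hk
    nlinarith
  have hk' : (k : ℝ) ≤ 0 := by
    have : k < 1 := by exact_mod_cast hk
    exact_mod_cast Int.le_of_lt_add_one this
  nlinarith

/-- A short move between rows goes towards lower rows. -/
lemma sub_row_nonpos {c c' u v u' v' : ℝ} (h : SlidRows c u v) (h' : SlidRows c' u' v')
    (hd : u' - u < Real.sqrt 2) : u' - u ≤ 0 := by
  obtain ⟨k, hk⟩ := h.exists_row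
  obtain ⟨l, hl⟩ := h'.exists_row
  have := mul_int_nonpos (t := u' - u) (s := 0) (k := l - k)
    (by rw [hk, hl]; push_cast; ring) (by linarith)
  linarith

/-- A short move along the negative rows follows the drift of these rows. -/
lemma sub_along_le {c c' u v u' v' : ℝ} (h : SlidRows c u v) (h' : SlidRows c' u' v')
    (hu : u < 0) (hu' : u' < 0) (hd : v' - v < Real.sqrt 2 - (c' - c)) :
    v' - v ≤ -(c' - c) := by
  obtain ⟨k, hk⟩ := h.exists_of_neg hu
  obtain ⟨l, hl⟩ := h'.exists_of_neg hu'
  exact mul_int_nonpos (k := l - k) (by rw [hk, hl]; push_cast; ring) hd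

lemma exists_near_int (t c : ℝ) : ∃ m : ℤ, |Real.sqrt 2 * m + c - t| ≤ Real.sqrt 2 / 2 := by
  have h2 : 0 < Real.sqrt 2 := by positivity
  refine ⟨round ((t - c) / Real.sqrt 2), ?_⟩
  have h := abs_sub_round ((t - c) / Real.sqrt 2)
  rw [abs_sub_comm] at h
  have e : Real.sqrt 2 * (round ((t - c) / Real.sqrt 2) : ℤ) + c - t
      = Real.sqrt 2 * ((round ((t - c) / Real.sqrt 2) : ℤ) - (t - c) / Real.sqrt 2) := by
    field_simp
    ring
  rw [e, abs_mul, abs_of_pos h2]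
  nlinarith

lemma exists_near (c u v : ℝ) :
    ∃ u' v', SlidRows c u' v' ∧ |u' - u| ≤ Real.sqrt 2 / 2 ∧ |v' - v| ≤ Real.sqrt 2 / 2 := by
  have h2 : Real.sqrt 2 ≠ 0 := by positivity
  obtain ⟨k, hk⟩ := exists_near_int u (Real.sqrt 2 / 2)
  have hcos : Real.cos (Real.pi * (Real.sqrt 2 * k + Real.sqrt 2 / 2) / Real.sqrt 2) = 0 := by
    rw [Real.cos_eq_zero_iff]
    exact ⟨k, by field_simp⟩
  rcases le_total 0 (Real.sqrt 2 * k + Real.sqrt 2 / 2) with h0 | h0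
  · obtain ⟨m, hm⟩ := exists_near_int v c
    refine ⟨_, _, ⟨hcos, Or.inl ⟨h0, ?_⟩⟩, hk, hm⟩
    rw [Real.sin_eq_zero_iff]
    exact ⟨m, by field_simp; ring⟩
  · obtain ⟨m, hm⟩ := exists_near_int v (-c)
    refine ⟨_, _, ⟨hcos, Or.inr ⟨h0, ?_⟩⟩, hk, hm⟩
    rw [Real.sin_eq_zero_iff]
    exact ⟨m, by field_simp; ring⟩

lemma isClosed_setOf (c : ℝ) {X : Type*} [TopologicalSpace X] {f g : X → ℝ} (hf : Continuous f)
    (hg : Continuous g) : IsClosed {p | SlidRows c (f p) (g p)} := by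
  refine IsClosed.inter (isClosed_eq (by fun_prop) continuous_const)
    (IsClosed.union (IsClosed.inter (isClosed_le continuous_const hf)
      (isClosed_eq (by fun_prop) continuous_const))
      (IsClosed.inter (isClosed_le hf continuous_const)
      (isClosed_eq (by fun_prop) continuous_const)))

end SlidRows

/-- If the increments of a real sequence returning to its starting value differ by less than `C`,
then they are at most `C`. -/
lemma increment_le_of_closed {n : ℕ} (hn : 0 < n) {x : ℕ → ℝ} {C : ℝ} (hx : x n = x 0)
    (hd : ∀ i < n, ∀ j < n, (x (i + 1) - x i) - (x (j + 1) - x j) < C) :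
    ∀ i < n, x (i + 1) - x i ≤ C := by
  intro i hi
  by_contra! h
  have hpos : 0 < ∑ j ∈ Finset.range n, (x (j + 1) - x j) :=
    Finset.sum_pos (fun j hj => by linarith [hd i hi j (Finset.mem_range.1 hj)])
      ⟨0, Finset.mem_range.2 hn⟩
  rw [Finset.sum_range_sub] at hpos
  linarith

/-- No closed path that starts downwards has increments of diameter less than `1 + √2 - ε` if it
follows first the slid rows and then the slid columns. -/
lemma false_of_first_step_down {N : ℕ} {δ ε : ℝ} (hδ : 0 < δ) (hδε : δ ≤ ε) (hN : 15 < δ * N)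
    {x y : ℕ → ℝ} (hx0 : x 0 = 0) (hy0 : y 0 = 0) (hxn : x (2 * N + 5) = 0)
    (hyn : y (2 * N + 5) = 0) (hy1 : y 1 ≤ -1)
    (hrow : ∀ i, 2 ≤ i → i ≤ N + 2 → SlidRows (δ * i) (y i) (x i))
    (hcol : ∀ i, N + 3 ≤ i → i ≤ 2 * N + 3 → SlidRows (δ * i) (x i) (y i))
    (hx : 1 ≤ |x (2 * N + 4)|)
    (hdx : ∀ i < 2 * N + 5, ∀ j < 2 * N + 5,
      (x (i + 1) - x i) - (x (j + 1) - x j) < 1 + Real.sqrt 2 - ε)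
    (hdy : ∀ i < 2 * N + 5, ∀ j < 2 * N + 5,
      (y (i + 1) - y i) - (y (j + 1) - y j) < 1 + Real.sqrt 2 - ε) : False := by
  have hs2 : Real.sqrt 2 ≤ 3 / 2 := Real.sqrt_le_iff.2 ⟨by norm_num, by norm_num⟩
  have hs1 : 1 ≤ Real.sqrt 2 := Real.one_le_sqrt.2 (by norm_num)
  have bx : ∀ i < 2 * N + 5, x (i + 1) - x i ≤ 3 := fun i hi => by
    linarith [increment_le_of_closed (by omega) (hxn.trans hx0.symm) hdx i hi]
  have bY : ∀ i < 2 * N + 5, y (i + 1) - y i ≤ 3 := fun i hi => by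
    linarith [increment_le_of_closed (by omega) (hyn.trans hy0.symm) hdy i hi]
  have up : ∀ i < 2 * N + 5, y (i + 1) - y i < Real.sqrt 2 - ε := fun i hi => by
    have := hdy i hi 0 (by omega)
    simp only [zero_add] at this
    linarith
  have row_neg : ∀ k ≤ N, y (2 + k) ≤ -(Real.sqrt 2 / 2) := by
    intro k
    induction k with
    | zero =>
      intro _
      rcases (hrow 2 le_rfl (by omega)).le_or_ge with h | h
      · exact h
      · linarith [up 1 (by omega)]
    | succ k ih =>
      intro hk
      rcases (hrow (2 + (k + 1)) (by omega) (by omega)).le_or_ge with h | h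
      · exact h
      · have := up (2 + k) (by omega)
        rw [← add_assoc] at h
        linarith [ih (by omega)]
  have drift : ∀ i : ℕ, δ * (i + 1 : ℕ) - δ * i = δ := fun i => by push_cast; ring
  -- Along the rows, the path drifts to the left, so that some step leads to the right.
  have right : ∃ j < 2 * N + 5, Real.sqrt 2 - δ ≤ x (j + 1) - x j := by
    by_contra! h
    have h1 : ∀ k ≤ N, x (2 + k) ≤ 6 - δ * k := by
      intro k
      induction k with
      | zero =>
        intro _
        have h0 := bx 0 (by omega)
        have h1 := bx 1 (by omega)
        norm_num at h0 h1 ⊢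
        linarith
      | succ k ih =>
        intro hk
        have := (hrow (2 + k) (by omega) (by omega)).sub_along_le
          (hrow (2 + k + 1) (by omega) (by omega))
          (by linarith [row_neg k (by omega)])
          (by linarith [row_neg (k + 1) hk, show y (2 + k + 1) = y (2 + (k + 1)) from rfl])
          (by rw [drift]; exact h _ (by omega))
        rw [drift] at this
        have e : x (2 + (k + 1)) = x (2 + k + 1) := rfl
        rw [e]
        push_cast
        linarith [ih (by omega)]
    have h2 : ∀ k ≤ N, x (N + 3 + k) ≤ 9 - δ * N := by
      intro k
      induction k with
      | zero =>
        intro _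
        have e := h1 N le_rfl
        rw [add_comm 2 N] at e
        exact (by linarith [bx (N + 2) (by omega)] : x (N + 3) ≤ 9 - δ * N)
      | succ k ih =>
        intro hk
        have := (hcol (N + 3 + k) (by omega) (by omega)).sub_row_nonpos
          (hcol (N + 3 + k + 1) (by omega) (by omega)) (by linarith [h (N + 3 + k) (by omega)])
        exact (by linarith [ih (by omega)] : x (N + 3 + k + 1) ≤ 9 - δ * N)
    have e := h2 N le_rfl
    rw [show N + 3 + N = 2 * N + 3 by ring] at e
    have e1 := bx (2 * N + 3) (by omega)
    have e2 := bx (2 * N + 4) (by omega)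
    norm_num [add_assoc] at e1 e2
    linarith
  obtain ⟨j, hj, hjx⟩ := right
  have not_left : ∀ i < 2 * N + 5, -1 < x (i + 1) - x i := fun i hi => by
    linarith [hdx j hj i hi]
  have x_end : x (2 * N + 4) ≤ -1 := by
    have := not_left (2 * N + 4) (by omega)
    rw [show 2 * N + 4 + 1 = 2 * N + 5 from rfl, hxn] at this
    rcases le_abs'.1 hx with h | h <;> linarith
  have col_neg : ∀ k ≤ N, x (2 * N + 3 - k) ≤ -(Real.sqrt 2 / 2) := by
    intro k
    induction k with
    | zero =>
      intro _
      rcases (hcol (2 * N + 3) (by omega) (by omega)).le_or_ge with h | h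
      · exact h
      · linarith [not_left (2 * N + 3) (by omega),
          show x (2 * N + 3 + 1) = x (2 * N + 4) from rfl]
    | succ k ih =>
      intro hk
      rcases (hcol (2 * N + 3 - (k + 1)) (by omega) (by omega)).le_or_ge with h | h
      · exact h
      · have := not_left (2 * N + 3 - (k + 1)) (by omega)
        rw [show 2 * N + 3 - (k + 1) + 1 = 2 * N + 3 - k by omega] at this
        linarith [ih (by omega)]
  have h1 : ∀ k ≤ N, y (2 + k) ≤ 6 := by
    intro k
    induction k with
    | zero =>
      intro _
      have h0 := bY 0 (by omega)
      have h1 := bY 1 (by omega)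
      norm_num at h0 h1 ⊢
      linarith
    | succ k ih =>
      intro hk
      have := (hrow (2 + k) (by omega) (by omega)).sub_row_nonpos
        (hrow (2 + k + 1) (by omega) (by omega)) (by linarith [up (2 + k) (by omega)])
      exact (by linarith [ih (by omega)] : y (2 + k + 1) ≤ 6)
  have h2 : ∀ k ≤ N, y (N + 3 + k) ≤ 9 - δ * k := by
    intro k
    induction k with
    | zero =>
      intro _
      have e := h1 N le_rfl
      rw [add_comm 2 N] at e
      have := bY (N + 2) (by omega)
      norm_num [add_assoc] at this ⊢
      linarith
    | succ k ih =>
      intro hk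
      have c1 := col_neg (N - k) (by omega)
      have c2 := col_neg (N - (k + 1)) (by omega)
      rw [show 2 * N + 3 - (N - k) = N + 3 + k by omega] at c1
      rw [show 2 * N + 3 - (N - (k + 1)) = N + 3 + k + 1 by omega] at c2
      have := (hcol (N + 3 + k) (by omega) (by omega)).sub_along_le
        (hcol (N + 3 + k + 1) (by omega) (by omega)) (by linarith) (by linarith)
        (by rw [drift]; linarith [up (N + 3 + k) (by omega)])
      rw [drift] at this
      have e : y (N + 3 + (k + 1)) = y (N + 3 + k + 1) := rfl
      rw [e]
      push_cast
      linarith [ih (by omega)]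
  have e := h2 N le_rfl
  rw [show N + 3 + N = 2 * N + 3 by ring] at e
  have e1 := bY (2 * N + 3) (by omega)
  have e2 := bY (2 * N + 4) (by omega)
  norm_num [add_assoc] at e1 e2
  linarith

lemma exists_one_le_abs_near (t : ℝ) : ∃ t', 1 ≤ |t'| ∧ |t' - t| ≤ 1 := by
  rcases le_total 0 t with h | h
  · exact ⟨t + 1, by rw [abs_of_nonneg] <;> linarith, by simp⟩
  · exact ⟨t - 1, by rw [abs_of_nonpos] <;> linarith, by simp⟩

/-- The sets `{|y| ≥ 1}`, slid rows, slid columns and `{|x| ≥ 1}`, between two copies of `{0}`. -/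
def slidingGrid (N : ℕ) (δ : ℝ) (i : ℕ) : Set (EuclideanSpace ℝ (Fin 2)) :=
  if i = 0 then {0}
  else if i = 1 then {p | 1 ≤ |p 1|}
  else if i ≤ N + 2 then {p | SlidRows (δ * i) (p 1) (p 0)}
  else if i ≤ 2 * N + 3 then {p | SlidRows (δ * i) (p 0) (p 1)}
  else if i ≤ 2 * N + 4 then {p | 1 ≤ |p 0|}
  else {0}

lemma isClosed_slidingGrid (N : ℕ) (δ : ℝ) (i : ℕ) : IsClosed (slidingGrid N δ i) := by
  unfold slidingGrid
  split_ifs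
  · exact isClosed_singleton
  · exact isClosed_le continuous_const (by fun_prop)
  · exact SlidRows.isClosed_setOf _ (by fun_prop) (by fun_prop)
  · exact SlidRows.isClosed_setOf _ (by fun_prop) (by fun_prop)
  · exact isClosed_le continuous_const (by fun_prop)
  · exact isClosed_singleton

lemma norm_sub_le_one_of_sq {a : EuclideanSpace ℝ (Fin 2)} {u v : ℝ}
    (h : (u - a 0) ^ 2 + (v - a 1) ^ 2 ≤ 1) : ‖!₂[u, v] - a‖ ≤ 1 := by
  rw [EuclideanSpace.norm_eq]
  refine Real.sqrt_le_iff.2 ⟨zero_le_one, ?_⟩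
  simpa [Fin.sum_univ_two] using h

lemma sq_add_sq_le_one {s t : ℝ} (hs : |s| ≤ Real.sqrt 2 / 2) (ht : |t| ≤ Real.sqrt 2 / 2) :
    s ^ 2 + t ^ 2 ≤ 1 := by
  have h2 := Real.sq_sqrt (show (0 : ℝ) ≤ 2 by norm_num)
  have := sq_le_sq' (neg_le_of_abs_le hs) (le_of_abs_le hs)
  have := sq_le_sq' (neg_le_of_abs_le ht) (le_of_abs_le ht)
  nlinarith

lemma exists_mem_slidingGrid_near {N : ℕ} (δ : ℝ) {i : ℕ} (h1 : 1 ≤ i) (hn : i < 2 * N + 5)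
    (a : EuclideanSpace ℝ (Fin 2)) : ∃ y ∈ slidingGrid N δ i, ‖y - a‖ ≤ 1 := by
  unfold slidingGrid
  split_ifs with c0 c1 c2 c3 c4
  · omega
  · obtain ⟨t, ht, hta⟩ := exists_one_le_abs_near (a 1)
    exact ⟨!₂[a 0, t], by simpa using ht, norm_sub_le_one_of_sq (by simpa using hta)⟩
  · obtain ⟨u, v, h, hu, hv⟩ := SlidRows.exists_near (δ * i) (a 1) (a 0)
    exact ⟨!₂[v, u], by simpa using h, norm_sub_le_one_of_sq (sq_add_sq_le_one hv hu)⟩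
  · obtain ⟨u, v, h, hu, hv⟩ := SlidRows.exists_near (δ * i) (a 0) (a 1)
    exact ⟨!₂[u, v], by simpa using h, norm_sub_le_one_of_sq (sq_add_sq_le_one hu hv)⟩
  · obtain ⟨t, ht, hta⟩ := exists_one_le_abs_near (a 0)
    exact ⟨!₂[t, a 1], by simpa using ht, norm_sub_le_one_of_sq (by simpa using hta)⟩
  · omega

/-- **Theorem 4**: `D*_2 ≥ 1 + √2 ≈ 2.414`. For every `ε > 0` there exist `n ≥ 1`
and a grid-like sequence of closed sets `A 0, …, A n ⊆ ℝ²` (Euclidean norm) such that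
every transversal `a i ∈ A i` has two differences `z i = a i − a (i−1)`,
`z j = a j − a (j−1)` with `‖z i − z j‖ ≥ 1 + √2 − ε`. -/
theorem lower_bound_one_plus_sqrt_two (ε : ℝ) (hε : 0 < ε) :
    ∃ (n : ℕ) (A : ℕ → Set (EuclideanSpace ℝ (Fin 2))) (s : EuclideanSpace ℝ (Fin 2)),
      1 ≤ n ∧
      (∀ i, i ≤ n → IsClosed (A i)) ∧
      A 0 = {0} ∧ A n = {s} ∧
      (∀ i, 1 ≤ i → i < n → ∀ a : EuclideanSpace ℝ (Fin 2), ∃ y ∈ A i, ‖y - a‖ ≤ 1) ∧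
      ∀ a : ℕ → EuclideanSpace ℝ (Fin 2), (∀ i, i ≤ n → a i ∈ A i) →
        ∃ i j, 1 ≤ i ∧ i ≤ n ∧ 1 ≤ j ∧ j ≤ n ∧
          1 + Real.sqrt 2 - ε ≤ ‖(a i - a (i - 1)) - (a j - a (j - 1))‖ := by
  obtain ⟨N, hN⟩ := exists_nat_gt (15 / ε)
  rw [div_lt_iff₀' hε] at hN
  refine ⟨2 * N + 5, slidingGrid N ε, 0, by omega, fun i _ => isClosed_slidingGrid N ε i,
    by simp [slidingGrid],
    by simp [slidingGrid, show ¬ 2 * N + 3 ≤ N by omega],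
    fun i h1 hn a => exists_mem_slidingGrid_near ε h1 hn a, fun a ha => ?_⟩
  by_contra! hcon
  have coord : ∀ i < 2 * N + 5, ∀ j < 2 * N + 5, ∀ c : Fin 2,
      (a (i + 1) c - a i c) - (a (j + 1) c - a j c) < 1 + Real.sqrt 2 - ε := by
    intro i hi j hj c
    refine lt_of_le_of_lt ?_ (hcon (i + 1) (j + 1) (by omega) (by omega) (by omega) (by omega))
    refine (le_abs_self _).trans ?_
    simpa using PiLp.norm_apply_le ((a (i + 1) - a i) - (a (j + 1) - a j)) c
  have h0 : a 0 = 0 := by simpa [slidingGrid] using ha 0 (by omega)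
  have hn : a (2 * N + 5) = 0 := by
    simpa [slidingGrid, show ¬ 2 * N + 3 ≤ N by omega] using ha (2 * N + 5) le_rfl
  have h1 : 1 ≤ |a 1 1| := by simpa [slidingGrid] using ha 1 (by omega)
  have hx : 1 ≤ |a (2 * N + 4) 0| := by
    simpa [slidingGrid, show ¬ 2 * N + 4 ≤ N + 2 by omega] using ha (2 * N + 4) (by omega)
  have hrow : ∀ i, 2 ≤ i → i ≤ N + 2 → SlidRows (ε * i) (a i 1) (a i 0) := by
    intro i hi hi'
    simpa [slidingGrid, show i ≠ 0 by omega, show i ≠ 1 by omega, hi'] using ha i (by omega)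
  have hcol : ∀ i, N + 3 ≤ i → i ≤ 2 * N + 3 → SlidRows (ε * i) (a i 0) (a i 1) := by
    intro i hi hi'
    simpa [slidingGrid, show i ≠ 0 by omega, show i ≠ 1 by omega, show ¬ i ≤ N + 2 by omega, hi']
      using ha i (by omega)
  rcases le_abs'.1 h1 with h | h
  · exact false_of_first_step_down hε le_rfl hN (x := fun i => a i 0) (y := fun i => a i 1)
      (by simp [h0]) (by simp [h0]) (by simp [hn]) (by simp [hn]) h hrow hcol hx
      (fun i hi j hj => coord i hi j hj 0) (fun i hi j hj => coord i hi j hj 1)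
  · exact false_of_first_step_down hε le_rfl hN (x := fun i => -a i 0) (y := fun i => -a i 1)
      (by simp [h0]) (by simp [h0]) (by simp [hn]) (by simp [hn]) (neg_le_neg h)
      (fun i hi hi' => (hrow i hi hi').neg) (fun i hi hi' => (hcol i hi hi').neg)
      (by simpa using hx)
      (fun i hi j hj => by linarith [coord j hj i hi 0])
      (fun i hi j hj => by linarith [coord j hj i hi 1])
end
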